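/- Let (R, m) be a Noetherian local ring and let I be a proper ideal of R having finite Łojasiewicz exponent. Then for every positive integer k, the ideal I^k has finite Łojasiewicz exponent and 𝓛₀(I^k) = k·𝓛₀(I). -/

import Mathlib

open Finset IsLocalRing

/-- The set of elements integral over an ideal `I`: `x` is integral over `I` if it satisfies
an equation `x ^ k + c 1 * x ^ (k-1) + ⋯ + c k = 0` with `c i ∈ I ^ i`. -/
def integralClosureIdeal {R : Type*} [CommRing R] (I : Ideal R) : Set R :=
  {x | ∃ k : ℕ, 1 ≤ k ∧ ∃ c : ℕ → R, (∀ i, 1 ≤ i → i ≤ k → c i ∈ I ^ i) ∧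
    x ^ k + ∑ i ∈ Finset.Icc 1 k, c i * x ^ (k - i) = 0}

/-- `Λ(I)`: the set of rationals `r/s` (as real numbers) with `r, s` positive integers such that
`m ^ r` is contained in the integral closure of `I ^ s`. -/
def Lambda (R : Type*) [CommRing R] [IsLocalRing R] (I : Ideal R) : Set ℝ :=
  {x | ∃ r s : ℕ, 0 < r ∧ 0 < s ∧
    ((maximalIdeal R ^ r : Ideal R) : Set R) ⊆ integralClosureIdeal (I ^ s) ∧
    x = (r : ℝ) / (s : ℝ)}

/-- The Łojasiewicz exponent `𝓛₀(I)`, the infimum of `Λ(I)`. -/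
noncomputable def Loj (R : Type*) [CommRing R] [IsLocalRing R] (I : Ideal R) : ℝ :=
  sInf (Lambda R I)

open Polynomial in
theorem mem_integralClosureIdeal_of_monic {R : Type*} [CommRing R] {I : Ideal R} {x : R}
    {p : R[X]} (hp : p.Monic) (hd : 0 < p.natDegree)
    (hc : ∀ j, p.coeff j ∈ I ^ (p.natDegree - j)) (hx : p.eval x = 0) :
    x ∈ integralClosureIdeal I := by
  refine ⟨p.natDegree, hd, fun i => p.coeff (p.natDegree - i), fun i _ hi => ?_, ?_⟩
  · simpa [Nat.sub_sub_self hi] using hc (p.natDegree - i)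
  · rw [eval_eq_sum_range, Finset.sum_range_succ, hp.coeff_natDegree, one_mul, add_comm] at hx
    rw [← hx]
    congr 1
    refine Finset.sum_bij' (fun i _ => p.natDegree - i) (fun i _ => p.natDegree - i) ?_ ?_ ?_ ?_ ?_
    · intro i hi
      simp only [Finset.mem_Icc, Finset.mem_range] at *
      omega
    · intro i hi
      simp only [Finset.mem_Icc, Finset.mem_range] at *
      omega
    · intro i hi
      simp only [Finset.mem_Icc] at *
      omega
    · intro i hi
      simp only [Finset.mem_range] at *
      omega
    · intros
      rfl

theorem integralClosureIdeal_mono {R : Type*} [CommRing R] {I J : Ideal R} (h : I ≤ J) :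
    integralClosureIdeal I ⊆ integralClosureIdeal J := by
  rintro x ⟨k, hk, c, hc, hx⟩
  exact ⟨k, hk, c, fun i hi hik => Ideal.pow_right_mono h i (hc i hi hik), hx⟩

theorem sup_span_singleton_pow_succ_le {R : Type*} [CommRing R] (J : Ideal R) (x : R) (n : ℕ) :
    (J ⊔ Ideal.span {x}) ^ (n + 1) ≤ J * (J ⊔ Ideal.span {x}) ^ n ⊔ Ideal.span {x ^ (n + 1)} := by
  induction n with
  | zero => simp
  | succ n ih =>
    set K := J ⊔ Ideal.span {x} with hK
    calc K ^ (n + 1 + 1) = K ^ (n + 1) * K := pow_succ _ _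
      _ ≤ (J * K ^ n ⊔ Ideal.span {x ^ (n + 1)}) * K := Ideal.mul_mono_left ih
      _ = J * K ^ (n + 1) ⊔ (Ideal.span {x ^ (n + 1)} * J ⊔ Ideal.span {x ^ (n + 1 + 1)}) := by
        rw [Ideal.sup_mul, mul_assoc, ← pow_succ]
        congr 1
        rw [hK, Ideal.mul_sup, Ideal.span_singleton_mul_span_singleton, ← pow_succ]
      _ ≤ J * K ^ (n + 1) ⊔ Ideal.span {x ^ (n + 1 + 1)} := by
        refine sup_le le_sup_left (sup_le (le_sup_of_le_left ?_) le_sup_right)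
        rw [mul_comm]
        refine Ideal.mul_mono_right ?_
        rw [← Ideal.span_singleton_pow]
        exact Ideal.pow_right_mono le_sup_right _

theorem exists_sup_span_singleton_pow_succ_le_mul {R : Type*} [CommRing R] {J : Ideal R} {x : R}
    (hx : x ∈ integralClosureIdeal J) :
    ∃ n : ℕ, (J ⊔ Ideal.span {x}) ^ (n + 1) ≤ J * (J ⊔ Ideal.span {x}) ^ n := by
  obtain ⟨k, hk, c, hc, hx⟩ := hx
  obtain ⟨n, rfl⟩ := Nat.exists_eq_add_of_le' hk
  refine ⟨n, (sup_span_singleton_pow_succ_le J x n).trans (sup_le le_rfl ?_)⟩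
  rw [Ideal.span_singleton_le_iff_mem, eq_neg_of_add_eq_zero_left hx]
  refine neg_mem (sum_mem fun i hi => ?_)
  obtain ⟨hi1, hi2⟩ := Finset.mem_Icc.mp hi
  obtain ⟨j, rfl⟩ := Nat.exists_eq_add_of_le' hi1
  set K := J ⊔ Ideal.span {x}
  have hxK : x ∈ K := (le_sup_right : _ ≤ K) (Ideal.mem_span_singleton_self x)
  have hle : J ^ (j + 1) * K ^ (n + 1 - (j + 1)) ≤ J * K ^ n := by
    calc J ^ (j + 1) * K ^ (n + 1 - (j + 1)) = J * (J ^ j * K ^ (n - j)) := by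
          rw [pow_succ', mul_assoc, Nat.add_sub_add_right]
      _ ≤ J * (K ^ j * K ^ (n - j)) :=
          Ideal.mul_mono_right (Ideal.mul_mono_left (Ideal.pow_right_mono le_sup_left _))
      _ = J * K ^ n := by rw [← pow_add, Nat.add_sub_cancel' (by omega)]
  exact hle (Ideal.mul_mem_mul (hc _ hi1 hi2) (Ideal.pow_mem_pow hxK _))

theorem pow_add_le_pow_mul_pow {R : Type*} [CommRing R] {J L : Ideal R} {n : ℕ}
    (h : L ^ (n + 1) ≤ J * L ^ n) (k : ℕ) : L ^ (n + k) ≤ J ^ k * L ^ n := by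
  induction k with
  | zero => simp
  | succ k ih =>
    calc L ^ (n + (k + 1)) = L ^ (n + k) * L := by rw [← add_assoc, pow_succ]
      _ ≤ J ^ k * L ^ n * L := Ideal.mul_mono_left ih
      _ = J ^ k * L ^ (n + 1) := by rw [mul_assoc, ← pow_succ]
      _ ≤ J ^ k * (J * L ^ n) := Ideal.mul_mono_right h
      _ = J ^ (k + 1) * L ^ n := by rw [← mul_assoc, ← pow_succ]

theorem exists_pow_succ_le_mul_pow_trans {R : Type*} [CommRing R] {J K L : Ideal R} (hKL : K ≤ L)
    (hJK : ∃ n : ℕ, K ^ (n + 1) ≤ J * K ^ n) (hKL' : ∃ n : ℕ, L ^ (n + 1) ≤ K * L ^ n) :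
    ∃ n : ℕ, L ^ (n + 1) ≤ J * L ^ n := by
  obtain ⟨n, hn⟩ := hJK
  obtain ⟨m, hm⟩ := hKL'
  refine ⟨n + m, ?_⟩
  calc L ^ (n + m + 1) = L ^ (m + (n + 1)) := by congr 1; omega
    _ ≤ K ^ (n + 1) * L ^ m := pow_add_le_pow_mul_pow hm _
    _ ≤ J * K ^ n * L ^ m := Ideal.mul_mono_left hn
    _ ≤ J * L ^ n * L ^ m := Ideal.mul_mono_left (Ideal.mul_mono_right (Ideal.pow_right_mono hKL _))
    _ = J * L ^ (n + m) := by rw [mul_assoc, ← pow_add]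

theorem exists_sup_pow_succ_le_mul_pow {R : Type*} [CommRing R] {J M : Ideal R} (hM : M.FG)
    (h : (M : Set R) ⊆ integralClosureIdeal J) :
    ∃ n : ℕ, (J ⊔ M) ^ (n + 1) ≤ J * (J ⊔ M) ^ n := by
  classical
  obtain ⟨s, rfl⟩ := hM
  replace h : (s : Set R) ⊆ integralClosureIdeal J := Ideal.subset_span.trans h
  induction s using Finset.induction_on with
  | empty => exact ⟨0, by simp⟩
  | insert a s _ ih =>
    rw [Finset.coe_insert, Set.insert_subset_iff] at h
    have hspan : J ⊔ Ideal.span ((insert a s : Finset R) : Set R) =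
        J ⊔ Ideal.span (s : Set R) ⊔ Ideal.span {a} := by
      rw [Finset.coe_insert, Ideal.span_insert, sup_assoc, sup_comm (Ideal.span {a})]
    change ∃ n : ℕ, (J ⊔ Ideal.span ((insert a s : Finset R) : Set R)) ^ (n + 1) ≤
      J * (J ⊔ Ideal.span ((insert a s : Finset R) : Set R)) ^ n
    rw [hspan]
    exact exists_pow_succ_le_mul_pow_trans le_sup_left (ih h.2)
      (exists_sup_span_singleton_pow_succ_le_mul (integralClosureIdeal_mono le_sup_left h.1))

open Polynomial in
theorem mem_integralClosureIdeal_of_mul_mem {R : Type*} [CommRing R] {I N : Ideal R} (hN : N.FG)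
    {x : R} (hx : ∀ y ∈ N, x * y ∈ I * N) {n : ℕ} (hxn : x ^ n ∈ N) :
    x ∈ integralClosureIdeal I := by
  cases subsingleton_or_nontrivial R
  · exact ⟨1, le_rfl, 0, fun _ _ _ => zero_mem _, Subsingleton.elim _ _⟩
  have : Module.Finite R N := Module.Finite.iff_fg.mpr hN
  obtain ⟨p, hp, -, hc, hpx⟩ :=
    LinearMap.exists_monic_and_natDegree_eq_and_coeff_mem_pow_and_aeval_eq_zero R
      (algebraMap R (Module.End R N) x) I (by
        rintro _ ⟨y, rfl⟩
        rw [Submodule.mem_smul_top_iff]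
        exact hx y y.2)
  have hann : ∀ y ∈ N, p.eval x * y = 0 := by
    intro y hy
    rw [aeval_algebraMap_apply] at hpx
    simpa using congrArg Subtype.val (LinearMap.congr_fun hpx ⟨y, hy⟩)
  have hdeg : (p * X ^ (n + 1)).natDegree = p.natDegree + (n + 1) := by
    rw [hp.natDegree_mul (monic_X_pow _), natDegree_X_pow]
  refine mem_integralClosureIdeal_of_monic (p := p * X ^ (n + 1)) (hp.mul (monic_X_pow _))
    (by omega) (fun j => ?_) ?_
  · rw [hdeg, coeff_mul_X_pow']
    split_ifs with hj
    · have := hc (j - (n + 1))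
      rwa [show p.natDegree + (n + 1) - j = p.natDegree - (j - (n + 1)) by omega]
    · exact zero_mem _
  · rw [eval_mul, eval_pow, eval_X]
    exact hann _ (by rw [pow_succ]; exact N.mul_mem_right _ hxn)

theorem pow_subset_integralClosureIdeal_pow {R : Type*} [CommRing R] [IsNoetherianRing R]
    {J M : Ideal R} (h : (M : Set R) ⊆ integralClosureIdeal J) {k : ℕ} (hk : 0 < k) :
    ((M ^ k : Ideal R) : Set R) ⊆ integralClosureIdeal (J ^ k) := by
  intro x hx
  obtain ⟨n, hn⟩ := exists_sup_pow_succ_le_mul_pow (IsNoetherian.noetherian M) h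
  have hxL : x ∈ (J ⊔ M) ^ k := Ideal.pow_right_mono le_sup_right k hx
  refine mem_integralClosureIdeal_of_mul_mem (IsNoetherian.noetherian ((J ⊔ M) ^ n))
    (fun y hy => pow_add_le_pow_mul_pow hn k ?_) (n := n) ?_
  · rw [add_comm, pow_add]
    exact Ideal.mul_mem_mul hxL hy
  · exact Ideal.pow_mem_pow (Ideal.pow_le_self hk.ne' hxL) n

theorem Lambda_pow {R : Type*} [CommRing R] [IsNoetherianRing R] [IsLocalRing R]
    (I : Ideal R) {k : ℕ} (hk : 0 < k) :
    Lambda R (I ^ k) = (fun x => (k : ℝ) * x) '' Lambda R I := by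
  have hk' : (k : ℝ) ≠ 0 := by positivity
  ext x
  constructor
  · rintro ⟨r, s, hr, hs, h, rfl⟩
    refine ⟨r / (k * s : ℕ), ⟨r, k * s, hr, by positivity, by rwa [pow_mul], rfl⟩, ?_⟩
    push_cast
    field_simp
  · rintro ⟨_, ⟨r, s, hr, hs, h, rfl⟩, rfl⟩
    refine ⟨r * k, s, by positivity, hs, ?_, ?_⟩
    · rw [pow_mul, ← pow_mul I, mul_comm k s, pow_mul I]
      exact pow_subset_integralClosureIdeal_pow h hk
    · push_cast
      ring

theorem loj_pow
    {R : Type*} [CommRing R] [IsNoetherianRing R] [IsLocalRing R]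
    (I : Ideal R) (hI : I ≠ ⊤) (hIfin : (Lambda R I).Nonempty) (k : ℕ) (hk : 0 < k) :
    (Lambda R (I ^ k)).Nonempty ∧ Loj R (I ^ k) = (k : ℝ) * Loj R I := by
  rw [Loj, Loj, Lambda_pow I hk]
  exact ⟨hIfin.image _, by simpa only [← Set.image_smul, smul_eq_mul] using
    Real.sInf_smul_of_nonneg (Nat.cast_nonneg (α := ℝ) k) (Lambda R I)⟩
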